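/- Determinant expression for the related numbers of (first order) Appell polynomials: let f(t) = Σ_{n≥0} d_n t^n/n! be a formal power series over ℂ with d_0 = 1, and define the numbers a_n by 1/f(t) = Σ_{n≥0} a_n t^n/n!. Then for every n ≥ 1, a_n = (−1)^n · n! · det M, where M is the n×n matrix whose (i,j) entry (1 ≤ i, j ≤ n) is d_{i−j+1}/(i−j+1)! if i ≥ j, is 1 if j = i+1, and is 0 if j > i+1. -/

import Mathlib

open PowerSeries in
/-- The lower triangular Toeplitz matrix of a power series sends the vector of the first
coefficients of `g` to that of `f * g`. -/
theorem sum_toeplitz_mul_coeff {R : Type*} [CommRing R] (f g : PowerSeries R) (n : ℕ)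
    (i : Fin (n + 1)) :
    ∑ j : Fin (n + 1), (if (j : ℕ) ≤ i then coeff ((i : ℕ) - j) f else 0) * coeff (j : ℕ) g =
      coeff (i : ℕ) (f * g) := by
  rw [mul_comm f g, coeff_mul, Finset.Nat.sum_antidiagonal_eq_sum_range_succ
    (fun p q => coeff p g * coeff q f),
    Fin.sum_univ_eq_sum_range
      (fun j => (if j ≤ (i : ℕ) then coeff ((i : ℕ) - j) f else 0) * coeff j g)]
  symm
  refine Finset.sum_subset_zero_on_sdiff
    (Finset.range_subset_range.2 (Nat.succ_le_succ (Nat.le_of_lt_succ i.2))) ?_ ?_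
  · intro j hj
    have : ¬ j ≤ (i : ℕ) := by
      simp only [Finset.mem_sdiff, Finset.mem_range] at hj
      omega
    simp [this]
  · intro j hj
    have : j ≤ (i : ℕ) := Nat.le_of_lt_succ (Finset.mem_range.1 hj)
    simp [this, mul_comm]

open PowerSeries in
/-- Wronski's determinant formula for the coefficients of the inverse of a power series with
constant coefficient `1`. -/
theorem coeff_eq_det_of_mul_eq_one {R : Type*} [CommRing R] (f g : PowerSeries R)
    (hf : coeff 0 f = 1) (hfg : f * g = 1) (n : ℕ) :
    coeff n g = (-1) ^ n * Matrix.det (Matrix.of fun i j : Fin n =>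
      if (j : ℕ) ≤ (i : ℕ) + 1 then coeff ((i : ℕ) + 1 - j) f else 0) := by
  set T : Matrix (Fin (n + 1)) (Fin (n + 1)) R :=
    Matrix.of fun i j => if (j : ℕ) ≤ i then coeff ((i : ℕ) - j) f else 0 with hT
  have hdet : T.det = 1 := by
    rw [Matrix.det_of_isLowerTriangular]
    · simp [hT, -coeff_zero_eq_constantCoeff, hf]
    · intro i j hij
      have : ¬ (j : ℕ) ≤ i := not_le.2 hij
      rw [hT, Matrix.of_apply, if_neg this]
  have hmul : T.mulVec (fun j => coeff (j : ℕ) g) = Pi.single 0 1 := by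
    ext i
    simp only [Matrix.mulVec, dotProduct, hT, Matrix.of_apply]
    rw [sum_toeplitz_mul_coeff, hfg, coeff_one]
    simp only [Pi.single_apply, Fin.ext_iff, Fin.val_zero]
  have hadj := congrArg (fun v => T.adjugate.mulVec v (Fin.last n)) hmul
  simp only [Matrix.mulVec_mulVec, Matrix.adjugate_mul, hdet, one_smul, Matrix.one_mulVec,
    Matrix.mulVec_single_one, Matrix.col_apply, Fin.val_last] at hadj
  rw [hadj, Matrix.adjugate_fin_succ_eq_det_submatrix]
  simp only [Fin.val_zero, Fin.val_last, zero_add]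
  congr 2
  ext i j
  simp only [hT, Matrix.submatrix_apply, Matrix.of_apply, Fin.succAbove_zero, Fin.succAbove_last,
    Fin.val_succ, Fin.val_castSucc]

/-- Determinant expression for the related numbers of (first order) Appell polynomials. -/
theorem appell_det_first_order (d : ℕ → ℂ) (hd : d 0 = 1)
    (a : ℕ → ℂ)
    (ha : (PowerSeries.mk fun n => d n / (n.factorial : ℂ))⁻¹ =
      PowerSeries.mk fun n => a n / (n.factorial : ℂ))
    (n : ℕ) (hn : 1 ≤ n) :
    a n = (-1 : ℂ) ^ n * (n.factorial : ℂ) *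
      Matrix.det (Matrix.of fun i j : Fin n =>
        if (j : ℕ) ≤ (i : ℕ) then
          d ((i : ℕ) - (j : ℕ) + 1) / ((((i : ℕ) - (j : ℕ) + 1).factorial : ℂ))
        else if (j : ℕ) = (i : ℕ) + 1 then 1
        else 0) := by
  set f : PowerSeries ℂ := PowerSeries.mk fun n => d n / (n.factorial : ℂ) with hf
  have hf0 : PowerSeries.coeff 0 f = 1 := by simp only [hf, PowerSeries.coeff_mk]; simp [hd]
  have hfg : f * f⁻¹ = 1 := PowerSeries.mul_inv_cancel f (by
    rw [← PowerSeries.coeff_zero_eq_constantCoeff_apply, hf0]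
    exact one_ne_zero)
  have key := coeff_eq_det_of_mul_eq_one f f⁻¹ hf0 hfg n
  rw [ha, PowerSeries.coeff_mk, div_eq_iff (by exact_mod_cast n.factorial_ne_zero)] at key
  rw [key, mul_right_comm]
  congr 3
  ext i j
  rcases lt_trichotomy (j : ℕ) (i + 1) with h | h | h
  · have h' : (j : ℕ) ≤ i := Nat.le_of_lt_succ h
    simp [hf, h', h.le, Nat.sub_add_comm h']
  · simp [h, -PowerSeries.coeff_zero_eq_constantCoeff, hf0]
  · simp [show ¬ (j : ℕ) ≤ i by omega, show ¬ (j : ℕ) ≤ i + 1 by omega,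
      show ¬ (j : ℕ) = i + 1 by omega]
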